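/- arXiv:2402.02294 — 6 statements merged into one kernel-verified Lean document; each statement's English description precedes it below -/
import Mathlib

section
/- Let U ⊆ ℝ⁴ be open and let Γ : U → (Fin 4 → Fin 4 → Fin 4 → ℝ), written Γ^ρ_{αβ}, be a smooth family of connection coefficients that is symmetric in its lower indices (Γ^ρ_{αβ} = Γ^ρ_{βα}). For each μ ∈ Fin 4 define the first-order differential operator L_μ acting on smooth functions f : U × Matrix (Fin 4) (Fin 4) ℝ → ℝ by (L_μ f)(x,E) = Σ_k E^k_μ (∂f/∂x^k)(x,E) − Σ_{ρ,σ,α,β} Γ^ρ_{αβ}(x) E^α_μ E^β_σ (∂f/∂E^ρ_σ)(x,E), where E^a_b denotes the (a,b) entry of E. Define the curvature tensor R^σ_{μνρ}(x) = ∂_ν Γ^σ_{μρ} − ∂_μ Γ^σ_{νρ} + Σ_α (Γ^α_{μρ} Γ^σ_{αν} − Γ^α_{νρ} Γ^σ_{αμ}). Then for every smooth f and all μ,ν ∈ Fin 4, (L_μ(L_ν f) − L_ν(L_μ f))(x,E) = Σ_{α,β,ρ,τ,σ} E^α_μ E^β_ν R^ρ_{αβτ}(x) E^τ_σ (∂f/∂E^ρ_σ)(x,E);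 in particular the commutator [L_μ, L_ν] involves no derivatives in the x-variables (it is vertical). -/
open Matrix

attribute [local instance] Matrix.normedAddCommGroup Matrix.normedSpace

/-- The fundamental horizontal vector field L_μ on the (trivialised) frame bundle
(ℝ⁴ × frames), associated to connection coefficients Γ^ρ_{αβ}:
(L_μ f)(x,E) = Σ_k E^k_μ ∂f/∂x^k − Σ_{ρ,σ,α,β} Γ^ρ_{αβ}(x) E^α_μ E^β_σ ∂f/∂E^ρ_σ,
expressed as the derivative of f at (x,E) in the direction
(E·e_μ, −Γ(x)(E·e_μ, E·)). -/
noncomputable def Lhoriz (Γ : (Fin 4 → ℝ) → Fin 4 → Fin 4 → Fin 4 → ℝ) (μ : Fin 4)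
    (f : (Fin 4 → ℝ) × Matrix (Fin 4) (Fin 4) ℝ → ℝ)
    (p : (Fin 4 → ℝ) × Matrix (Fin 4) (Fin 4) ℝ) : ℝ :=
  fderiv ℝ f p
    ((fun k => p.2 k μ),
      Matrix.of fun ρ σ => -∑ α : Fin 4, ∑ β : Fin 4, Γ p.1 ρ α β * p.2 α μ * p.2 β σ)

/-- Partial derivative of a function of x ∈ ℝ⁴ in the ν-th coordinate direction. -/
noncomputable def pdx (ν : Fin 4) (F : (Fin 4 → ℝ) → ℝ) (x : Fin 4 → ℝ) : ℝ :=
  fderiv ℝ F x (Pi.single ν 1)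

/-- The curvature tensor of the connection Γ:
R^σ_{μνρ} = ∂_ν Γ^σ_{μρ} − ∂_μ Γ^σ_{νρ} + Σ_α (Γ^α_{μρ}Γ^σ_{αν} − Γ^α_{νρ}Γ^σ_{αμ}).
Here `curv Γ x σ μ ν ρ` is R^σ_{μνρ}(x). -/
noncomputable def curv (Γ : (Fin 4 → ℝ) → Fin 4 → Fin 4 → Fin 4 → ℝ)
    (x : Fin 4 → ℝ) (σ μ ν ρ : Fin 4) : ℝ :=
  pdx ν (fun y => Γ y σ μ ρ) x - pdx μ (fun y => Γ y σ ν ρ) x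
    + ∑ α : Fin 4, (Γ x α μ ρ * Γ x σ α ν - Γ x α ν ρ * Γ x σ α μ)

/-- The horizontal vector field whose associated derivation is `Lhoriz Γ μ`. -/
noncomputable def horizontalField (Γ : (Fin 4 → ℝ) → Fin 4 → Fin 4 → Fin 4 → ℝ) (μ : Fin 4)
    (p : (Fin 4 → ℝ) × Matrix (Fin 4) (Fin 4) ℝ) : (Fin 4 → ℝ) × Matrix (Fin 4) (Fin 4) ℝ :=
  ((fun k => p.2 k μ),
    Matrix.of fun ρ σ => -∑ α : Fin 4, ∑ β : Fin 4, Γ p.1 ρ α β * p.2 α μ * p.2 β σ)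

/-- The projection of the trivialised frame bundle onto a matrix entry. -/
noncomputable def entryProj (i j : Fin 4) :
    ((Fin 4 → ℝ) × Matrix (Fin 4) (Fin 4) ℝ) →L[ℝ] ℝ :=
  LinearMap.toContinuousLinearMap
    ((Matrix.entryLinearMap ℝ ℝ i j).comp
      (LinearMap.snd ℝ (Fin 4 → ℝ) (Matrix (Fin 4) (Fin 4) ℝ)))

/-- The projection of the trivialised frame bundle onto a base coordinate. -/
noncomputable def baseProj (k : Fin 4) :
    ((Fin 4 → ℝ) × Matrix (Fin 4) (Fin 4) ℝ) →L[ℝ] ℝ :=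
  (ContinuousLinearMap.proj k).comp (ContinuousLinearMap.fst ℝ _ _)

lemma fderiv_apply_eq_sum_pdx (F : (Fin 4 → ℝ) → ℝ) (x v : Fin 4 → ℝ) :
    fderiv ℝ F x v = ∑ k, v k * pdx k F x := by
  conv_lhs => rw [← Finset.univ_sum_single v]
  rw [map_sum]
  refine Finset.sum_congr rfl fun k _ => ?_
  have : (Pi.single k (v k) : Fin 4 → ℝ) = v k • Pi.single k 1 := by
    rw [← Pi.single_smul]; simp
  rw [this, map_smul, smul_eq_mul, pdx]

lemma vertical_apply_eq_sum (φ : ((Fin 4 → ℝ) × Matrix (Fin 4) (Fin 4) ℝ) →L[ℝ] ℝ)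
    (M : Matrix (Fin 4) (Fin 4) ℝ) :
    φ (0, M) = ∑ ρ, ∑ σ, M ρ σ * φ (0, Matrix.of (Pi.single ρ (Pi.single σ 1))) := by
  have h : ((0 : Fin 4 → ℝ), M)
      = ∑ ρ, ∑ σ, M ρ σ • ((0 : Fin 4 → ℝ), Matrix.of (Pi.single ρ (Pi.single σ 1))) := by
    refine Prod.ext ?_ ?_
    · simp [Prod.fst_sum]
    · ext i j
      simp [Prod.snd_sum, Matrix.sum_apply, Pi.single_apply, Finset.sum_ite_eq, ite_apply]
  conv_lhs => rw [h]
  simp only [map_sum, map_smul, smul_eq_mul]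

lemma hasFDerivAt_neg_sum_mul_mul {E ι : Type*} [NormedAddCommGroup E] [NormedSpace ℝ E]
    [Fintype ι] {a b c : ι → ι → E → ℝ} {a' b' c' : ι → ι → E →L[ℝ] ℝ} {p : E}
    (ha : ∀ i j, HasFDerivAt (a i j) (a' i j) p) (hb : ∀ i j, HasFDerivAt (b i j) (b' i j) p)
    (hc : ∀ i j, HasFDerivAt (c i j) (c' i j) p) :
    ∃ L : E →L[ℝ] ℝ, HasFDerivAt (fun q => -∑ i, ∑ j, a i j q * b i j q * c i j q) L p ∧
      ∀ v, L v = -∑ i, ∑ j, (a' i j v * b i j p * c i j p + a i j p * b' i j v * c i j p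
        + a i j p * b i j p * c' i j v) := by
  refine ⟨_, (HasFDerivAt.fun_sum fun i _ => HasFDerivAt.fun_sum fun j _ =>
    ((ha i j).mul (hb i j)).mul (hc i j)).neg, fun v => ?_⟩
  simp only [_root_.neg_apply, _root_.sum_apply, _root_.add_apply, _root_.smul_apply, smul_eq_mul,
    Pi.mul_apply]
  congr 1
  refine Finset.sum_congr rfl fun i _ => Finset.sum_congr rfl fun j _ => ?_
  ring

lemma hasFDerivAt_vertical_component {Γ : (Fin 4 → ℝ) → Fin 4 → Fin 4 → Fin 4 → ℝ}
    {p : (Fin 4 → ℝ) × Matrix (Fin 4) (Fin 4) ℝ}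
    (hΓ : ∀ ρ α β, DifferentiableAt ℝ (fun y => Γ y ρ α β) p.1) (μ ρ σ : Fin 4) :
    ∃ L : ((Fin 4 → ℝ) × Matrix (Fin 4) (Fin 4) ℝ) →L[ℝ] ℝ,
      HasFDerivAt (fun q : (Fin 4 → ℝ) × Matrix (Fin 4) (Fin 4) ℝ =>
        -∑ α : Fin 4, ∑ β : Fin 4, Γ q.1 ρ α β * q.2 α μ * q.2 β σ) L p ∧
      ∀ v, L v = -∑ α : Fin 4, ∑ β : Fin 4,
        ((∑ k, v.1 k * pdx k (fun y => Γ y ρ α β) p.1) * p.2 α μ * p.2 β σ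
          + Γ p.1 ρ α β * v.2 α μ * p.2 β σ + Γ p.1 ρ α β * p.2 α μ * v.2 β σ) := by
  have h1 : ∀ α β, HasFDerivAt (fun q : (Fin 4 → ℝ) × Matrix (Fin 4) (Fin 4) ℝ => Γ q.1 ρ α β)
      ((fderiv ℝ (fun y => Γ y ρ α β) p.1).comp (ContinuousLinearMap.fst ℝ _ _)) p :=
    fun α β => (hΓ ρ α β).hasFDerivAt.comp p hasFDerivAt_fst
  have h2 : ∀ i j, HasFDerivAt (fun q : (Fin 4 → ℝ) × Matrix (Fin 4) (Fin 4) ℝ => q.2 i j)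
      (entryProj i j) p := fun i j => (entryProj i j).hasFDerivAt
  obtain ⟨L, hL, hLv⟩ := hasFDerivAt_neg_sum_mul_mul h1 (fun α _ => h2 α μ) (fun _ β => h2 β σ)
  refine ⟨L, hL, fun v => (hLv v).trans ?_⟩
  congr 1
  refine Finset.sum_congr rfl fun α _ => Finset.sum_congr rfl fun β _ => ?_
  rw [← fderiv_apply_eq_sum_pdx]
  rfl

lemma differentiableAt_horizontalField {Γ : (Fin 4 → ℝ) → Fin 4 → Fin 4 → Fin 4 → ℝ}
    {p : (Fin 4 → ℝ) × Matrix (Fin 4) (Fin 4) ℝ}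
    (hΓ : ∀ ρ α β, DifferentiableAt ℝ (fun y => Γ y ρ α β) p.1) (μ : Fin 4) :
    DifferentiableAt ℝ (horizontalField Γ μ) p := by
  refine DifferentiableAt.prodMk (differentiableAt_pi.2 fun k => ?_) ?_
  · exact (entryProj k μ).differentiableAt
  · refine differentiableAt_pi.2 fun ρ => differentiableAt_pi.2 fun σ => ?_
    obtain ⟨L, hL, -⟩ := hasFDerivAt_vertical_component hΓ μ ρ σ
    exact hL.differentiableAt

lemma fderiv_horizontalField_fst {Γ : (Fin 4 → ℝ) → Fin 4 → Fin 4 → Fin 4 → ℝ}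
    {p : (Fin 4 → ℝ) × Matrix (Fin 4) (Fin 4) ℝ}
    (hΓ : ∀ ρ α β, DifferentiableAt ℝ (fun y => Γ y ρ α β) p.1) (μ : Fin 4)
    (v : (Fin 4 → ℝ) × Matrix (Fin 4) (Fin 4) ℝ) (k : Fin 4) :
    (fderiv ℝ (horizontalField Γ μ) p v).1 k = v.2 k μ := by
  have h := (baseProj k).hasFDerivAt.comp p (differentiableAt_horizontalField hΓ μ).hasFDerivAt
  exact congrArg (fun L => L v) (h.unique (entryProj k μ).hasFDerivAt)

lemma fderiv_horizontalField_snd {Γ : (Fin 4 → ℝ) → Fin 4 → Fin 4 → Fin 4 → ℝ}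
    {p : (Fin 4 → ℝ) × Matrix (Fin 4) (Fin 4) ℝ}
    (hΓ : ∀ ρ α β, DifferentiableAt ℝ (fun y => Γ y ρ α β) p.1) (μ : Fin 4)
    (v : (Fin 4 → ℝ) × Matrix (Fin 4) (Fin 4) ℝ) (ρ σ : Fin 4) :
    (fderiv ℝ (horizontalField Γ μ) p v).2 ρ σ = -∑ α : Fin 4, ∑ β : Fin 4,
        ((∑ k, v.1 k * pdx k (fun y => Γ y ρ α β) p.1) * p.2 α μ * p.2 β σ
          + Γ p.1 ρ α β * v.2 α μ * p.2 β σ + Γ p.1 ρ α β * p.2 α μ * v.2 β σ) := by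
  obtain ⟨L, hL, hLv⟩ := hasFDerivAt_vertical_component hΓ μ ρ σ
  have h := (entryProj ρ σ).hasFDerivAt.comp p (differentiableAt_horizontalField hΓ μ).hasFDerivAt
  rw [← hLv]
  exact congrArg (fun L => L v) (h.unique hL)

lemma sum_symm_lower {G : Fin 4 → Fin 4 → ℝ} (hG : ∀ a b, G a b = G b a)
    (u v : Fin 4 → ℝ) :
    ∑ a, ∑ b, G a b * u a * v b = ∑ a, ∑ b, G a b * v a * u b := by
  rw [Finset.sum_comm]
  refine Finset.sum_congr rfl fun a _ => Finset.sum_congr rfl fun b _ => ?_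
  rw [hG]; ring

/-- The bracket of two horizontal fields is vertical, with components given by the curvature. -/
lemma lieBracket_horizontalField {Γ : (Fin 4 → ℝ) → Fin 4 → Fin 4 → Fin 4 → ℝ}
    {p : (Fin 4 → ℝ) × Matrix (Fin 4) (Fin 4) ℝ}
    (hΓ : ∀ ρ α β, DifferentiableAt ℝ (fun y => Γ y ρ α β) p.1)
    (hsym : ∀ ρ α β, Γ p.1 ρ α β = Γ p.1 ρ β α) (μ ν : Fin 4) :
    VectorField.lieBracket ℝ (horizontalField Γ μ) (horizontalField Γ ν) p
      = (0, Matrix.of fun ρ σ => ∑ α, ∑ β, ∑ τ,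
          p.2 α μ * p.2 β ν * curv Γ p.1 ρ α β τ * p.2 τ σ) := by
  refine Prod.ext (funext fun k => ?_) (Matrix.ext fun ρ σ => ?_)
  · refine (congrArg₂ HSub.hSub (fderiv_horizontalField_fst hΓ ν (horizontalField Γ μ p) k)
      (fderiv_horizontalField_fst hΓ μ (horizontalField Γ ν p) k)).trans ?_
    simp only [horizontalField, Matrix.of_apply, Pi.zero_apply]
    rw [sum_symm_lower (hsym k) (fun a => p.2 a μ) (fun a => p.2 a ν), sub_self]
  · refine (congrArg₂ HSub.hSub (fderiv_horizontalField_snd hΓ ν (horizontalField Γ μ p) ρ σ)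
      (fderiv_horizontalField_snd hΓ μ (horizontalField Γ ν p) ρ σ)).trans ?_
    simp only [horizontalField, Matrix.of_apply]
    have hmid : ∀ α, ∑ a, ∑ b, Γ p.1 α a b * p.2 a μ * p.2 b ν
        = ∑ a, ∑ b, Γ p.1 α a b * p.2 a ν * p.2 b μ := fun α =>
      sum_symm_lower (hsym α) (fun a => p.2 a μ) (fun a => p.2 a ν)
    have hder : ∀ u v : Fin 4 → ℝ, ∑ α, ∑ β, (∑ k, u k * pdx k (fun y => Γ y ρ α β) p.1)
          * v α * p.2 β σ
        = ∑ α, ∑ β, ∑ τ, u α * v β * pdx α (fun y => Γ y ρ β τ) p.1 * p.2 τ σ := by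
      intro u v
      simp only [Finset.sum_mul]
      conv_rhs => rw [Finset.sum_comm]
      refine Finset.sum_congr rfl fun a _ => ?_
      rw [Finset.sum_comm]
      conv_lhs => rw [Finset.sum_comm]
      conv_rhs => rw [Finset.sum_comm]
      refine Finset.sum_congr rfl fun b _ => Finset.sum_congr rfl fun c _ => ?_
      ring
    have hquad : ∀ u v : Fin 4 → ℝ, ∑ α, ∑ β, Γ p.1 ρ α β * v α *
          (-∑ a, ∑ b, Γ p.1 β a b * u a * p.2 b σ)
        = -∑ α, ∑ β, ∑ τ, u α * v β * (∑ γ, Γ p.1 γ α τ * Γ p.1 ρ γ β) * p.2 τ σ := by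
      intro u v
      simp only [Finset.sum_mul, Finset.mul_sum, mul_neg, Finset.sum_neg_distrib, neg_inj]
      conv_rhs => rw [Finset.sum_comm]
      refine Finset.sum_congr rfl fun a _ => ?_
      rw [Finset.sum_comm]
      refine Finset.sum_congr rfl fun b _ => ?_
      rw [Finset.sum_comm]
      refine Finset.sum_congr rfl fun c _ => Finset.sum_congr rfl fun d _ => ?_
      rw [hsym ρ a d]
      ring
    have hswap : ∀ T : Fin 4 → Fin 4 → Fin 4 → ℝ,
        ∑ α, ∑ β, ∑ τ, p.2 α ν * p.2 β μ * T α β τ * p.2 τ σ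
          = ∑ α, ∑ β, ∑ τ, p.2 α μ * p.2 β ν * T β α τ * p.2 τ σ := by
      intro T
      rw [Finset.sum_comm]
      refine Finset.sum_congr rfl fun a _ => Finset.sum_congr rfl fun b _ =>
        Finset.sum_congr rfl fun c _ => ?_
      ring
    simp only [Finset.sum_add_distrib]
    rw [hder (fun a => p.2 a μ) (fun a => p.2 a ν), hder (fun a => p.2 a ν) (fun a => p.2 a μ),
      hquad (fun a => p.2 a μ) (fun a => p.2 a ν), hquad (fun a => p.2 a ν) (fun a => p.2 a μ),
      hswap (fun α β τ => pdx α (fun y => Γ y ρ β τ) p.1),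
      hswap (fun α β τ => ∑ γ, Γ p.1 γ α τ * Γ p.1 ρ γ β)]
    simp only [hmid, curv, Finset.sum_sub_distrib, mul_add, add_mul, mul_sub, sub_mul,
      Finset.sum_add_distrib]
    ring

lemma fderiv_commutator_eq_lieBracket {E : Type*} [NormedAddCommGroup E] [NormedSpace ℝ E]
    {f : E → ℝ} {V W : E → E} {p : E} (hf : ContDiffAt ℝ 2 f p)
    (hV : DifferentiableAt ℝ V p) (hW : DifferentiableAt ℝ W p) :
    fderiv ℝ (fun q => fderiv ℝ f q (W q)) p (V p) - fderiv ℝ (fun q => fderiv ℝ f q (V q)) p (W p)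
      = fderiv ℝ f p (VectorField.lieBracket ℝ V W p) := by
  have hdf : DifferentiableAt ℝ (fderiv ℝ f) p :=
    (hf.fderiv_right (m := 1) (by norm_num)).differentiableAt (by norm_num)
  have hsymm := (hf.isSymmSndFDerivAt (by simp)).eq (V p) (W p)
  rw [(hdf.hasFDerivAt.clm_apply hV.hasFDerivAt).fderiv,
    (hdf.hasFDerivAt.clm_apply hW.hasFDerivAt).fderiv]
  simp [VectorField.lieBracket, hsymm]

/-- Commutation of the fundamental horizontal vector fields: for a torsion-free
(symmetric) smooth family of connection coefficients Γ on an open set U ⊆ ℝ⁴ and any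
smooth f on U × (4×4 matrices),
[L_μ, L_ν]f (x,E) = Σ_{α,β,ρ,τ,σ} E^α_μ E^β_ν R^ρ_{αβτ}(x) E^τ_σ ∂f/∂E^ρ_σ (x,E);
in particular the commutator is vertical (involves no x-derivatives of f). -/
theorem horizontal_commutator_vertical
    (U : Set (Fin 4 → ℝ)) (hU : IsOpen U)
    (Γ : (Fin 4 → ℝ) → Fin 4 → Fin 4 → Fin 4 → ℝ)
    (hΓ : ContDiffOn ℝ (⊤ : ℕ∞) Γ U)
    (hΓsym : ∀ x ∈ U, ∀ ρ α β : Fin 4, Γ x ρ α β = Γ x ρ β α)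
    (f : (Fin 4 → ℝ) × Matrix (Fin 4) (Fin 4) ℝ → ℝ)
    (hf : ContDiffOn ℝ (⊤ : ℕ∞) f (U ×ˢ (Set.univ : Set (Matrix (Fin 4) (Fin 4) ℝ))))
    (μ ν : Fin 4) :
    ∀ x ∈ U, ∀ E : Matrix (Fin 4) (Fin 4) ℝ,
      Lhoriz Γ μ (Lhoriz Γ ν f) (x, E) - Lhoriz Γ ν (Lhoriz Γ μ f) (x, E)
      = ∑ α : Fin 4, ∑ β : Fin 4, ∑ ρ : Fin 4, ∑ τ : Fin 4, ∑ σ : Fin 4,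
          E α μ * E β ν * curv Γ x ρ α β τ * E τ σ *
            fderiv ℝ f (x, E) (0, Matrix.of (Pi.single ρ (Pi.single σ 1))) := by
  intro x hx E
  have hΓx : ContDiffAt ℝ (⊤ : ℕ∞) Γ x := hΓ.contDiffAt (hU.mem_nhds hx)
  have hΓd : ∀ ρ α β, DifferentiableAt ℝ (fun y => Γ y ρ α β) x := fun ρ α β =>
    differentiableAt_pi.1 (differentiableAt_pi.1 (differentiableAt_pi.1
      (hΓx.differentiableAt (by simp)) ρ) α) β
  have hfx : ContDiffAt ℝ 2 f (x, E) :=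
    (hf.contDiffAt ((hU.prod isOpen_univ).mem_nhds ⟨hx, Set.mem_univ E⟩)).of_le
      (WithTop.coe_le_coe.2 le_top)
  refine (fderiv_commutator_eq_lieBracket hfx
    (differentiableAt_horizontalField (p := (x, E)) hΓd μ)
    (differentiableAt_horizontalField (p := (x, E)) hΓd ν)).trans ?_
  rw [lieBracket_horizontalField (p := (x, E)) hΓd (hΓsym x hx)]
  refine (vertical_apply_eq_sum (fderiv ℝ f (x, E)) _).trans ?_
  simp only [Matrix.of_apply, Finset.sum_mul]
  have hcomm : ∀ F : Fin 4 → Fin 4 → Fin 4 → Fin 4 → Fin 4 → ℝ,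
      ∑ ρ, ∑ σ, ∑ α, ∑ β, ∑ τ, F α β ρ τ σ = ∑ α, ∑ β, ∑ ρ, ∑ τ, ∑ σ, F α β ρ τ σ := by
    intro F
    calc ∑ ρ, ∑ σ, ∑ α, ∑ β, ∑ τ, F α β ρ τ σ
        = ∑ ρ, ∑ α, ∑ β, ∑ τ, ∑ σ, F α β ρ τ σ := by
          refine Finset.sum_congr rfl fun ρ _ => ?_
          rw [Finset.sum_comm]
          refine Finset.sum_congr rfl fun α _ => ?_
          rw [Finset.sum_comm]
          exact Finset.sum_congr rfl fun β _ => Finset.sum_comm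
      _ = ∑ α, ∑ β, ∑ ρ, ∑ τ, ∑ σ, F α β ρ τ σ := by
          rw [Finset.sum_comm]
          exact Finset.sum_congr rfl fun α _ => Finset.sum_comm
  exact hcomm fun α β ρ τ σ => E α μ * E β ν * curv Γ x ρ α β τ * E τ σ *
    fderiv ℝ f (x, E) (0, Matrix.of (Pi.single ρ (Pi.single σ 1)))
end

section
/- (Pauli's fundamental theorem, existence.) Let η = diag(1,−1,−1,−1) and let γ, γ' : Fin 4 → Matrix (Fin 4) (Fin 4) ℂ be two representations of the gamma matrices, i.e. γ^μ γ^ν + γ^ν γ^μ = 2 η^{μν} I and γ'^μ γ'^ν + γ'^ν γ'^μ = 2 η^{μν} I for all μ,ν ∈ Fin 4. Then there exists an invertible complex 4×4 matrix S such that γ^μ = S γ'^μ S⁻¹ for all μ ∈ Fin 4. -/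
open Matrix

/-- The Minkowski metric matrix η = diag(1,−1,−1,−1), complex version. -/
noncomputable def etaC : Matrix (Fin 4) (Fin 4) ℂ := Matrix.diagonal ![1, -1, -1, -1]

/-- A representation of the gamma matrices: γ^μ γ^ν + γ^ν γ^μ = 2 η^{μν} I. -/
def IsGammaRep (γ : Fin 4 → Matrix (Fin 4) (Fin 4) ℂ) : Prop :=
  ∀ μ ν : Fin 4, γ μ * γ ν + γ ν * γ μ = (2 * etaC μ ν) • (1 : Matrix (Fin 4) (Fin 4) ℂ)

/-- The canonical anticommutation relations for two modes, with annihilation operators `a`, `c`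
and creation operators `b`, `d`. -/
structure IsCAR {R : Type*} [Ring R] (a b c d : R) : Prop where
  aa : a * a = 0
  bb : b * b = 0
  cc : c * c = 0
  dd : d * d = 0
  ab : a * b = 1 - b * a
  cd : c * d = 1 - d * c
  ca : c * a = -(a * c)
  ad : a * d = -(d * a)
  cb : c * b = -(b * c)
  db : d * b = -(b * d)

theorem IsCAR.mul_ne_zero {R : Type*} [Ring R] [Nontrivial R] {a b c d : R}
    (h : IsCAR a b c d) : a * c ≠ 0 := by
  intro hac
  have ha : a = 0 := by
    calc a = a * (c * d + d * c) := by rw [h.cd]; simp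
      _ = a * c * d + a * d * c := by noncomm_ring
      _ = a * c * d - d * (a * c) := by rw [h.ad]; noncomm_ring
      _ = 0 := by simp [hac]
  have h1 := h.ab
  simp [ha] at h1

/-- The Fock-space matrix of `a` in the basis `v, b v, d v, b d v` of states built on the vacuum `v`. -/
def fockA : Matrix (Fin 4) (Fin 4) ℂ := !![0, 1, 0, 0; 0, 0, 0, 0; 0, 0, 0, 1; 0, 0, 0, 0]

/-- The Fock-space matrix of `b` in the basis of `fockA`. -/
def fockB : Matrix (Fin 4) (Fin 4) ℂ := !![0, 0, 0, 0; 1, 0, 0, 0; 0, 0, 0, 0; 0, 0, 1, 0]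

/-- The Fock-space matrix of `c` in the basis of `fockA`. -/
def fockC : Matrix (Fin 4) (Fin 4) ℂ := !![0, 0, 1, 0; 0, 0, 0, -1; 0, 0, 0, 0; 0, 0, 0, 0]

/-- The Fock-space matrix of `d` in the basis of `fockA`. -/
def fockD : Matrix (Fin 4) (Fin 4) ℂ := !![0, 0, 0, 0; 0, 0, 0, 0; 1, 0, 0, 0; 0, -1, 0, 0]

theorem mul_eq_mul_of_mulVec_col {M T G : Matrix (Fin 4) (Fin 4) ℂ}
    (h : ∀ k, M *ᵥ T.col k = ∑ l, G l k • T.col l) : M * T = T * G := by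
  ext i k
  have := congrFun (h k) i
  simpa [mulVec, dotProduct, mul_apply, mul_comm] using this

/-- Every four-dimensional representation of the two-mode canonical anticommutation relations
is equivalent to the Fock representation. -/
theorem IsCAR.exists_intertwiner {a b c d : Matrix (Fin 4) (Fin 4) ℂ} (h : IsCAR a b c d) :
    ∃ T : Matrix (Fin 4) (Fin 4) ℂ, IsUnit T.det ∧
      a * T = T * fockA ∧ b * T = T * fockB ∧ c * T = T * fockC ∧ d * T = T * fockD := by
  obtain ⟨w, hw⟩ : ∃ w, (a * c) *ᵥ w ≠ 0 := by
    by_contra! hw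
    exact h.mul_ne_zero (Matrix.ext_of_mulVec_single fun i => by rw [hw, zero_mulVec])
  have apply_eq {M N : Matrix (Fin 4) (Fin 4) ℂ} (hMN : M = N) (u : Fin 4 → ℂ) :
      M *ᵥ u = N *ᵥ u := by rw [hMN]
  have aa u : a *ᵥ a *ᵥ u = 0 := by simpa using apply_eq h.aa u
  have bb u : b *ᵥ b *ᵥ u = 0 := by simpa using apply_eq h.bb u
  have cc u : c *ᵥ c *ᵥ u = 0 := by simpa using apply_eq h.cc u
  have dd u : d *ᵥ d *ᵥ u = 0 := by simpa using apply_eq h.dd u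
  have ab u : a *ᵥ b *ᵥ u = u - b *ᵥ a *ᵥ u := by simpa [sub_mulVec] using apply_eq h.ab u
  have cd u : c *ᵥ d *ᵥ u = u - d *ᵥ c *ᵥ u := by simpa [sub_mulVec] using apply_eq h.cd u
  have ca u : c *ᵥ a *ᵥ u = -(a *ᵥ c *ᵥ u) := by simpa [neg_mulVec] using apply_eq h.ca u
  have ad u : a *ᵥ d *ᵥ u = -(d *ᵥ a *ᵥ u) := by simpa [neg_mulVec] using apply_eq h.ad u
  have cb u : c *ᵥ b *ᵥ u = -(b *ᵥ c *ᵥ u) := by simpa [neg_mulVec] using apply_eq h.cb u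
  have db u : d *ᵥ b *ᵥ u = -(b *ᵥ d *ᵥ u) := by simpa [neg_mulVec] using apply_eq h.db u
  obtain ⟨v, hv, av, cv⟩ : ∃ v, v ≠ 0 ∧ a *ᵥ v = 0 ∧ c *ᵥ v = 0 :=
    ⟨a *ᵥ c *ᵥ w, by simpa using hw, aa _, by simp [ca, cc, -mulVec_mulVec]⟩
  let e : Fin 4 → Fin 4 → ℂ := ![v, b *ᵥ v, d *ᵥ v, b *ᵥ d *ᵥ v]
  let T : Matrix (Fin 4) (Fin 4) ℂ := of fun i k => e k i
  have hT k : T.col k = e k := rfl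
  refine ⟨T, ?_, ?_, ?_, ?_, ?_⟩
  · rw [isUnit_iff_ne_zero]
    intro hdet
    obtain ⟨x, hx, hTx⟩ := exists_mulVec_eq_zero_iff.mpr hdet
    have hsum : x 0 • v + x 1 • b *ᵥ v + x 2 • d *ᵥ v + x 3 • b *ᵥ d *ᵥ v = 0 := by
      rw [← hTx]
      ext i
      simp [mulVec, dotProduct, Fin.sum_univ_four, T, e, mul_comm]
    have ha := congrArg (a *ᵥ ·) hsum
    simp only [mulVec_add, mulVec_smul, mulVec_zero, av, ab, ad, neg_zero, sub_zero, smul_zero,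
      zero_add, add_zero] at ha
    have hca := congrArg (c *ᵥ ·) ha
    have x3 : x 3 = 0 := by simpa [mulVec_add, mulVec_smul, cv, cd, hv] using hca
    have x1 : x 1 = 0 := by simpa [x3, hv] using ha
    have hc := congrArg (c *ᵥ ·) hsum
    have x2 : x 2 = 0 := by simpa [mulVec_add, mulVec_smul, cv, cd, x1, x3, hv] using hc
    have x0 : x 0 = 0 := by simpa [x1, x2, x3, hv] using hsum
    exact hx (funext fun i => by fin_cases i <;> assumption)
  all_goals
    refine mul_eq_mul_of_mulVec_col fun k => ?_
    fin_cases k <;>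
      simp [hT, e, Fin.sum_univ_four, fockA, fockB, fockC, fockD, av, cv, bb, dd, ab, cd, ad, cb,
        db, -mulVec_mulVec]

/-- The gamma matrices in the Fock basis. -/
noncomputable def fockGamma : Fin 4 → Matrix (Fin 4) (Fin 4) ℂ :=
  ![fockA + fockB, -Complex.I • (fockC + fockD), fockD - fockC, fockA - fockB]

theorem IsGammaRep.isCAR {γ : Fin 4 → Matrix (Fin 4) (Fin 4) ℂ} (hγ : IsGammaRep γ) :
    IsCAR ((1 / 2 : ℂ) • (γ 0 + γ 3)) ((1 / 2 : ℂ) • (γ 0 - γ 3))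
      ((1 / 2 : ℂ) • (Complex.I • γ 1 - γ 2)) ((1 / 2 : ℂ) • (Complex.I • γ 1 + γ 2)) := by
  have sq μ : γ μ * γ μ = etaC μ μ • 1 := by
    have h := hγ μ μ
    rw [← two_smul ℂ, mul_smul] at h
    exact smul_right_injective _ (two_ne_zero' ℂ) h
  have anti {μ ν : Fin 4} (hne : μ ≠ ν) : γ μ * γ ν = -(γ ν * γ μ) := by
    have h := hγ μ ν
    rw [etaC, diagonal_apply_ne _ hne, mul_zero, zero_smul] at h
    exact eq_neg_of_add_eq_zero_left h
  have s0 : γ 0 * γ 0 = 1 := by simpa [etaC] using sq 0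
  have s1 : γ 1 * γ 1 = -1 := by simpa [etaC] using sq 1
  have s2 : γ 2 * γ 2 = -1 := by simpa [etaC] using sq 2
  have s3 : γ 3 * γ 3 = -1 := by simpa [etaC] using sq 3
  have h10 := anti (show (1 : Fin 4) ≠ 0 by decide)
  have h20 := anti (show (2 : Fin 4) ≠ 0 by decide)
  have h30 := anti (show (3 : Fin 4) ≠ 0 by decide)
  have h21 := anti (show (2 : Fin 4) ≠ 1 by decide)
  have h31 := anti (show (3 : Fin 4) ≠ 1 by decide)
  have h32 := anti (show (3 : Fin 4) ≠ 2 by decide)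
  constructor <;>
    simp only [smul_mul_assoc, mul_smul_comm, mul_add, add_mul, mul_sub, sub_mul, s0, s1, s2, s3,
      h10, h20, h30, h21, h31, h32] <;>
    (match_scalars <;> ring_nf <;> simp <;> norm_num)

theorem IsGammaRep.exists_intertwiner {γ : Fin 4 → Matrix (Fin 4) (Fin 4) ℂ}
    (hγ : IsGammaRep γ) :
    ∃ T : Matrix (Fin 4) (Fin 4) ℂ, IsUnit T.det ∧ ∀ μ, γ μ * T = T * fockGamma μ := by
  obtain ⟨T, hT, ha, hb, hc, hd⟩ := hγ.isCAR.exists_intertwiner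
  refine ⟨T, hT, fun μ => ?_⟩
  fin_cases μ <;>
    simp only [fockGamma, Fin.zero_eta, Fin.mk_one, Fin.reduceFinMk, cons_val, mul_add, mul_sub,
      mul_smul_comm, ← ha, ← hb, ← hc, ← hd, smul_mul_assoc, add_mul, sub_mul] <;>
    (match_scalars <;> ring_nf <;> simp)

/-- Pauli's fundamental theorem (existence): any two representations of the gamma
matrices are conjugate by an invertible matrix S: γ^μ = S γ'^μ S⁻¹. -/
theorem pauli_existence
    (γ γ' : Fin 4 → Matrix (Fin 4) (Fin 4) ℂ)
    (hγ : IsGammaRep γ) (hγ' : IsGammaRep γ') :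
    ∃ S : Matrix (Fin 4) (Fin 4) ℂ, IsUnit S.det ∧ ∀ μ : Fin 4, γ μ = S * γ' μ * S⁻¹ := by
  obtain ⟨T, hT, h⟩ := hγ.exists_intertwiner
  obtain ⟨T', hT', h'⟩ := hγ'.exists_intertwiner
  refine ⟨T * T'⁻¹, ?_, fun μ => ?_⟩
  · rw [det_mul]
    exact hT.mul (isUnit_nonsing_inv_det _ hT')
  · have key : T'⁻¹ * γ' μ * T' = fockGamma μ := by
      rw [mul_assoc, h', nonsing_inv_mul_cancel_left _ _ hT']
    rw [Matrix.mul_inv_rev, nonsing_inv_nonsing_inv _ hT']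
    calc γ μ = γ μ * T * T⁻¹ := (mul_nonsing_inv_cancel_right _ _ hT).symm
      _ = T * (T'⁻¹ * γ' μ * T') * T⁻¹ := by rw [h, key]
      _ = T * T'⁻¹ * γ' μ * (T' * T⁻¹) := by simp only [mul_assoc]
end

section
/- (Pauli's fundamental theorem, uniqueness up to scalar.) Let η = diag(1,−1,−1,−1) and let γ : Fin 4 → Matrix (Fin 4) (Fin 4) ℂ be a representation of the gamma matrices, i.e. γ^μ γ^ν + γ^ν γ^μ = 2 η^{μν} I for all μ,ν ∈ Fin 4. If T is an invertible complex 4×4 matrix commuting with all four matrices γ^μ (T γ^μ = γ^μ T for all μ), then T = c·I for some nonzero complex scalar c. Consequently, if S and S' are two invertible matrices with S γ^μ S⁻¹ = S' γ^μ S'⁻¹ for all μ, then S' = c·S for some nonzero complex scalar c. -/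
open Matrix

/-- A nonzero subspace stable under an involution contains an eigenvector with eigenvalue `±1`. -/
lemma exists_eigenvector_of_involution {V : Type*} [AddCommGroup V] [Module ℂ V]
    (f : Module.End ℂ V) (hf : f * f = 1) (p : Submodule ℂ V) (hp : p ≠ ⊥)
    (hfp : ∀ v ∈ p, f v ∈ p) :
    ∃ w ∈ p, w ≠ 0 ∧ ∃ a : ℂ, (a = 1 ∨ a = -1) ∧ f w = a • w := by
  obtain ⟨v, hv, hv0⟩ := p.ne_bot_iff.mp hp
  have hff : f (f v) = v := LinearMap.congr_fun hf v
  by_cases h : v + f v = 0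
  · exact ⟨v, hv, hv0, -1, Or.inr rfl, by rw [neg_one_smul]; exact eq_neg_of_add_eq_zero_right h⟩
  · exact ⟨v + f v, p.add_mem hv (hfp v hv), h, 1, Or.inl rfl, by
      rw [map_add, hff, one_smul, add_comm]⟩

/-- Any operator on a four-dimensional space that commutes with `e 0, …, e 3` satisfying the
gamma matrix relations and has nontrivial kernel is zero. -/
lemma eq_zero_of_commute_gamma {V : Type*} [AddCommGroup V] [Module ℂ V] [FiniteDimensional ℂ V]
    (hV : Module.finrank ℂ V = 4) (e : Fin 4 → Module.End ℂ V)
    (h0 : e 0 * e 0 = 1) (hsq : ∀ i ≠ 0, e i * e i = -1)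
    (hanti : ∀ i j, i ≠ j → e i * e j = -(e j * e i))
    (f : Module.End ℂ V) (hf : ∀ i, Commute f (e i)) (hker : LinearMap.ker f ≠ ⊥) : f = 0 := by
  have h1 := hsq 1 (by decide)
  have h2 := hsq 2 (by decide)
  have h01 := hanti 0 1 (by decide)
  have h02 := hanti 0 2 (by decide)
  have h21 := hanti 2 1 (by decide)
  have h13 := hanti 1 3 (by decide)
  have h23 := hanti 2 3 (by decide)
  let b : Module.End ℂ V := Complex.I • (e 1 * e 2)
  have hb : b * b = 1 := by
    have h : e 1 * e 2 * (e 1 * e 2) = -1 := by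
      rw [mul_assoc, ← mul_assoc (e 2), h21, neg_mul, mul_assoc (e 1), h2]
      simp [h1]
    rw [smul_mul_smul_comm, h, Complex.I_mul_I, smul_neg, neg_smul, one_smul, neg_neg]
  have h0b : e 0 * b = b * e 0 := by
    simp only [b, mul_smul_comm, smul_mul_assoc]
    rw [← mul_assoc, h01, neg_mul, mul_assoc, h02, mul_neg, neg_neg, mul_assoc]
  have h1b : b * e 1 = -(e 1 * b) := by
    simp only [b, mul_smul_comm, smul_mul_assoc]
    rw [mul_assoc, h21, mul_neg, smul_neg]
  have h3b : b * e 3 = e 3 * b := by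
    simp only [b, mul_smul_comm, smul_mul_assoc]
    rw [mul_assoc, h23, mul_neg, ← mul_assoc, h13, neg_mul, neg_neg, mul_assoc]
  have hfe (i : Fin 4) (v : V) : f (e i v) = e i (f v) := LinearMap.congr_fun (hf i) v
  have hfb (v : V) : f (b v) = b (f v) := by simp [b, hfe]
  obtain ⟨u, hu, hu0, α, hα, huα⟩ := exists_eigenvector_of_involution (e 0) h0 (LinearMap.ker f)
    hker fun v hv => by
      rw [LinearMap.mem_ker] at hv ⊢
      rw [hfe, hv, map_zero]
  obtain ⟨w, ⟨hw, hwα⟩, hw0, β, hβ, hwβ⟩ := exists_eigenvector_of_involution b hb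
    (LinearMap.ker f ⊓ Module.End.eigenspace (e 0) α)
    ((Submodule.ne_bot_iff _).mpr ⟨u, ⟨hu, Module.End.mem_eigenspace_iff.mpr huα⟩, hu0⟩)
    fun v ⟨hv, hvα⟩ => by
      have hv : f v = 0 := hv
      refine ⟨?_, Module.End.mem_eigenspace_iff.mpr ?_⟩
      · change f (b v) = 0
        rw [hfb, hv, map_zero]
      · rw [← Module.End.mul_apply, h0b, Module.End.mul_apply,
          Module.End.mem_eigenspace_iff.mp hvα, map_smul]
  replace hw : f w = 0 := hw
  replace hwα : e 0 w = α • w := Module.End.mem_eigenspace_iff.mp hwα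
  have hne (i : Fin 4) (hi : i ≠ 0) (v : V) (hv : v ≠ 0) : e i v ≠ 0 := fun h => hv <| by
    have := LinearMap.congr_fun (hsq i hi) v
    simpa [h] using this.symm
  have h0e (i : Fin 4) (hi : i ≠ 0) (v : V) : e 0 (e i v) = -e i (e 0 v) :=
    LinearMap.congr_fun (hanti 0 i hi.symm) v
  have hb1 (v : V) : b (e 1 v) = -e 1 (b v) := LinearMap.congr_fun h1b v
  have hb3 (v : V) : b (e 3 v) = e 3 (b v) := LinearMap.congr_fun h3b v
  have hli : LinearIndependent ℂ ![w, e 3 w, e 1 w, e 1 (e 3 w)] := by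
    refine Module.End.eigenvectors_linearIndependent' (e 0 + (2 : ℂ) • b)
      ![α + 2 * β, -α + 2 * β, -α - 2 * β, α - 2 * β] ?_ _ ?_
    · intro i j hij
      rcases hα with rfl | rfl <;> rcases hβ with rfl | rfl <;> fin_cases i <;> fin_cases j <;>
        first | rfl | (norm_num at hij)
    · intro i
      refine Module.End.hasEigenvector_iff.mpr ⟨Module.End.mem_eigenspace_iff.mpr ?_, ?_⟩
      · fin_cases i <;> simp [h0e, hb1, hb3, hwα, hwβ] <;> module
      · fin_cases i
        · exact hw0
        · exact hne 3 (by decide) w hw0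
        · exact hne 1 (by decide) w hw0
        · exact hne 1 (by decide) _ (hne 3 (by decide) w hw0)
  let B := basisOfLinearIndependentOfCardEqFinrank hli (by simp [hV])
  refine B.ext fun i => ?_
  rw [coe_basisOfLinearIndependentOfCardEqFinrank]
  fin_cases i <;> simp [hfe, hw]

/-- Schur's lemma for gamma matrices: the commutant of a gamma representation is scalar. -/
lemma IsGammaRep.exists_eq_smul_one {γ : Fin 4 → Matrix (Fin 4) (Fin 4) ℂ} (hγ : IsGammaRep γ)
    (T : Matrix (Fin 4) (Fin 4) ℂ) (hT : ∀ μ, T * γ μ = γ μ * T) :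
    ∃ c : ℂ, T = c • (1 : Matrix (Fin 4) (Fin 4) ℂ) := by
  have hsq (μ : Fin 4) : γ μ * γ μ = etaC μ μ • (1 : Matrix (Fin 4) (Fin 4) ℂ) := by
    have h := hγ μ μ
    rw [← two_smul ℂ (γ μ * γ μ), mul_smul] at h
    exact smul_right_injective _ (two_ne_zero (α := ℂ)) h
  let φ := Matrix.toLinAlgEquiv' (R := ℂ) (n := Fin 4)
  obtain ⟨c, hc⟩ := Module.End.exists_eigenvalue (φ T)
  refine ⟨c, sub_eq_zero.mp (φ.injective ?_)⟩
  rw [map_zero]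
  refine eq_zero_of_commute_gamma (by simp) (fun μ => φ (γ μ)) ?_ ?_ ?_ _ ?_ ?_
  · rw [← map_mul, hsq]
    simp [etaC]
  · intro μ hμ
    rw [← map_mul, hsq]
    fin_cases μ <;> simp [etaC] at hμ ⊢
  · intro μ ν hμν
    have h := hγ μ ν
    rw [etaC, Matrix.diagonal_apply_ne _ hμν, mul_zero, zero_smul] at h
    rw [← map_mul, ← map_mul, ← map_neg, eq_neg_of_add_eq_zero_left h]
  · intro μ
    have h : Commute (T - c • 1) (γ μ) :=
      Commute.sub_left (hT μ) ((Commute.one_left _).smul_left c)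
    exact h.map φ
  · have h := hc
    rw [Module.End.hasEigenvalue_iff, Module.End.eigenspace_def] at h
    simpa [Algebra.algebraMap_eq_smul_one] using h

/-- Pauli's fundamental theorem (uniqueness up to scalar): an invertible matrix T
commuting with all the γ^μ of a gamma representation is a nonzero scalar multiple
of the identity; consequently two intertwiners S, S' conjugating the representation
the same way differ by a nonzero scalar: S' = c·S. -/
theorem pauli_uniqueness
    (γ : Fin 4 → Matrix (Fin 4) (Fin 4) ℂ) (hγ : IsGammaRep γ) :
    (∀ T : Matrix (Fin 4) (Fin 4) ℂ, IsUnit T.det →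
      (∀ μ : Fin 4, T * γ μ = γ μ * T) →
      ∃ c : ℂ, c ≠ 0 ∧ T = c • (1 : Matrix (Fin 4) (Fin 4) ℂ)) ∧
    (∀ S S' : Matrix (Fin 4) (Fin 4) ℂ, IsUnit S.det → IsUnit S'.det →
      (∀ μ : Fin 4, S * γ μ * S⁻¹ = S' * γ μ * S'⁻¹) →
      ∃ c : ℂ, c ≠ 0 ∧ S' = c • S) := by
  have scalar (T : Matrix (Fin 4) (Fin 4) ℂ) (hT : IsUnit T.det)
      (hc : ∀ μ : Fin 4, T * γ μ = γ μ * T) :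
      ∃ c : ℂ, c ≠ 0 ∧ T = c • (1 : Matrix (Fin 4) (Fin 4) ℂ) := by
    obtain ⟨c, rfl⟩ := hγ.exists_eq_smul_one T hc
    refine ⟨c, ?_, rfl⟩
    rintro rfl
    simp at hT
  refine ⟨scalar, fun S S' hS hS' h => ?_⟩
  obtain ⟨c, hc, hcT⟩ := scalar (S⁻¹ * S')
    (by rw [Matrix.det_mul]; exact (Matrix.isUnit_nonsing_inv_det S hS).mul hS') fun μ => by
      calc S⁻¹ * S' * γ μ = S⁻¹ * (S' * γ μ * S'⁻¹) * S' := by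
            simp only [mul_assoc, Matrix.nonsing_inv_mul _ hS', mul_one]
        _ = S⁻¹ * (S * γ μ * S⁻¹) * S' := by rw [h μ]
        _ = γ μ * (S⁻¹ * S') := by
            simp only [← mul_assoc, Matrix.nonsing_inv_mul _ hS, one_mul]
  refine ⟨c, hc, ?_⟩
  rw [← Matrix.mul_nonsing_inv_cancel_left S S' hS, hcT, Matrix.mul_smul, mul_one]
end

section
/- Let η = diag(1,−1,−1,−1) with entries η^{μν}. Let 𝒜 be an associative unital ℂ-algebra containing elements γ^μ, L_μ, A_μ (μ ∈ Fin 4) such that: (i) γ^μ γ^ν + γ^ν γ^μ = 2 η^{μν}·1 for all μ,ν; (ii) γ^μ commutes with L_ν and with A_ν for all μ,ν; (iii) the A_μ pairwise commute. Set D := Σ_μ γ^μ (L_μ + i A_μ). Then D² = Σ_{μ,ν} η^{μν}(L_μ + iA_μ)(L_ν + iA_ν) + (1/4) Σ_{μ,ν} [γ^μ, γ^ν][L_μ, L_ν] + (i/4) Σ_{μ,ν} [γ^μ, γ^ν]([L_μ, A_ν] − [L_ν, A_μ]), where [a,b] = ab − ba. -/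
/-- An antisymmetric family paired with `b` only sees the antisymmetrization of `b`. -/
theorem sum_antisymm_mul_sub_swap {ι R : Type*} [Fintype ι] [Ring R] (a b : ι → ι → R)
    (ha : ∀ i j, a j i = -a i j) :
    ∑ i, ∑ j, a i j * (b i j - b j i) = 2 * ∑ i, ∑ j, a i j * b i j := by
  have hswap : ∑ i, ∑ j, a i j * b j i = -∑ i, ∑ j, a i j * b i j := by
    rw [Finset.sum_comm]
    simp only [← Finset.sum_neg_distrib]
    exact Finset.sum_congr rfl fun i _ => Finset.sum_congr rfl fun j _ => by
      rw [ha i j, neg_mul]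
  simp only [mul_sub, Finset.sum_sub_distrib, hswap]
  noncomm_ring

/-- The square of `∑ i, γ i * X i` when the Clifford generators `γ i` commute with the `X j`. -/
theorem sum_clifford_mul_sq {ι R : Type*} [Fintype ι] [Ring R] [Algebra ℂ R]
    (c : ι → ι → ℂ) (γ X : ι → R)
    (hγ : ∀ i j, γ i * γ j + γ j * γ i = (2 * c i j) • (1 : R))
    (hγX : ∀ i j, γ i * X j = X j * γ i) :
    (∑ i, γ i * X i) * (∑ i, γ i * X i) =
      (∑ i, ∑ j, c i j • (X i * X j)) +
        ((1 : ℂ) / 4) • ∑ i, ∑ j, (γ i * γ j - γ j * γ i) * (X i * X j - X j * X i) := by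
  have hterm : ∀ i j, γ i * X i * (γ j * X j) =
      c i j • (X i * X j) + ((1 : ℂ) / 2) • ((γ i * γ j - γ j * γ i) * (X i * X j)) := by
    intro i j
    have hmove : γ i * X i * (γ j * X j) = γ i * γ j * (X i * X j) := by
      rw [mul_assoc, ← mul_assoc (X i), ← hγX j i]
      simp only [mul_assoc]
    have hsplit : γ i * γ j =
        c i j • (1 : R) + ((1 : ℂ) / 2) • (γ i * γ j - γ j * γ i) := by
      have hc : c i j • (1 : R) = ((1 : ℂ) / 2) • (γ i * γ j + γ j * γ i) := by
        rw [hγ, smul_smul]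
        congr 1
        ring
      rw [hc]
      module
    rw [hmove]
    conv_lhs => rw [hsplit]
    rw [add_mul, smul_mul_assoc, smul_mul_assoc, one_mul]
  rw [sum_antisymm_mul_sub_swap (fun i j => γ i * γ j - γ j * γ i) (fun i j => X i * X j)
    fun i j => (neg_sub _ _).symm]
  simp only [Finset.sum_mul_sum, hterm, Finset.sum_add_distrib, ← Finset.smul_sum, two_mul]
  module

/-- The square of the Dirac operator D = Σ_μ γ^μ(L_μ + iA_μ) in an associative
unital ℂ-algebra: if (i) the γ^μ satisfy the Clifford relations
γ^μγ^ν + γ^νγ^μ = 2η^{μν}·1, (ii) each γ^μ commutes with all L_ν and A_ν, and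
(iii) the A_μ pairwise commute, then
D² = Σ η^{μν}(L_μ+iA_μ)(L_ν+iA_ν) + ¼ Σ [γ^μ,γ^ν][L_μ,L_ν]
      + (i/4) Σ [γ^μ,γ^ν]([L_μ,A_ν] − [L_ν,A_μ]). -/
theorem dirac_operator_square
    {𝒜 : Type*} [Ring 𝒜] [Algebra ℂ 𝒜]
    (γ L A : Fin 4 → 𝒜)
    (hγ : ∀ μ ν : Fin 4, γ μ * γ ν + γ ν * γ μ = (2 * etaC μ ν) • (1 : 𝒜))
    (hγL : ∀ μ ν : Fin 4, γ μ * L ν = L ν * γ μ)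
    (hγA : ∀ μ ν : Fin 4, γ μ * A ν = A ν * γ μ)
    (hA : ∀ μ ν : Fin 4, A μ * A ν = A ν * A μ) :
    (∑ μ : Fin 4, γ μ * (L μ + Complex.I • A μ)) *
      (∑ μ : Fin 4, γ μ * (L μ + Complex.I • A μ))
    = (∑ μ : Fin 4, ∑ ν : Fin 4,
        etaC μ ν • ((L μ + Complex.I • A μ) * (L ν + Complex.I • A ν)))
      + ((1 : ℂ) / 4) • (∑ μ : Fin 4, ∑ ν : Fin 4,
          (γ μ * γ ν - γ ν * γ μ) * (L μ * L ν - L ν * L μ))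
      + (Complex.I / 4) • (∑ μ : Fin 4, ∑ ν : Fin 4,
          (γ μ * γ ν - γ ν * γ μ) *
            ((L μ * A ν - A ν * L μ) - (L ν * A μ - A μ * L ν))) := by
  have hγX : ∀ μ ν : Fin 4,
      γ μ * (L ν + Complex.I • A ν) = (L ν + Complex.I • A ν) * γ μ := fun μ ν => by
    rw [mul_add, add_mul, mul_smul_comm, smul_mul_assoc, hγL, hγA]
  have hcomm : ∀ μ ν : Fin 4,
      (L μ + Complex.I • A μ) * (L ν + Complex.I • A ν) -
          (L ν + Complex.I • A ν) * (L μ + Complex.I • A μ) =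
        (L μ * L ν - L ν * L μ) +
          Complex.I • ((L μ * A ν - A ν * L μ) - (L ν * A μ - A μ * L ν)) := fun μ ν => by
    simp only [mul_add, add_mul, mul_smul_comm, smul_mul_assoc, hA ν μ]
    module
  rw [sum_clifford_mul_sq (fun μ ν => etaC μ ν) γ (fun μ => L μ + Complex.I • A μ) hγ hγX]
  simp only [hcomm]
  simp only [mul_add, mul_smul_comm, Finset.sum_add_distrib, ← Finset.smul_sum]
  module
end

section
/- (Poincaré invariance of the Dirac operator over Minkowski space.) Let η = diag(1,−1,−1,−1). On ℝ⁴ × Matrix (Fin 4) (Fin 4) ℝ define (L_μ Ψ)(x,E) := (d/dt)|_{t=0} Ψ(x + t·(E e_μ), E) for Ψ differentiable in its first variable, where E e_μ is the μ-th column of E. Given γ : ℝ⁴ × Matrix (Fin 4) (Fin 4) ℝ → (Fin 4 → Matrix (Fin 4) (Fin 4) ℂ) and A : ℝ⁴ × Matrix (Fin 4) (Fin 4) ℝ → (Fin 4 → ℝ), define the Dirac operator (D_{[γ,A]} Ψ)(u) := Σ_μ γ^μ(u)·((L_μΨ)(u) + i A_μ(u) Ψ(u)) on ℂ⁴-valued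 fields Ψ differentiable in the first variable. Let Λ be a proper Lorentz matrix (Λᵀ η Λ = η, det Λ = 1, Λ^0_0 ≥ 1), b ∈ ℝ⁴, and F_♭(x,E) := (Λx + b, ΛE). Then (D_{[γ,A]} Ψ) ∘ F_♭ = D_{[γ∘F_♭, A∘F_♭]} (Ψ ∘ F_♭). -/
open Matrix

/-- The Minkowski metric matrix η = diag(1,−1,−1,−1). -/
noncomputable def etaR : Matrix (Fin 4) (Fin 4) ℝ := Matrix.diagonal ![1, -1, -1, -1]

/-- The fundamental horizontal vector field over Minkowski space:
(L_μ Ψ)(x,E) = (d/dt)|₀ Ψ(x + t·(E e_μ), E), differentiation of the ℂ⁴-valued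
field Ψ along the μ-th column of the frame matrix E. -/
noncomputable def Lfund (μ : Fin 4)
    (Ψ : (Fin 4 → ℝ) × Matrix (Fin 4) (Fin 4) ℝ → (Fin 4 → ℂ))
    (u : (Fin 4 → ℝ) × Matrix (Fin 4) (Fin 4) ℝ) : Fin 4 → ℂ :=
  deriv (fun t : ℝ => Ψ (u.1 + t • (fun k => u.2 k μ), u.2)) 0

/-- The Dirac operator D_{[γ,A]}Ψ = Σ_μ γ^μ(u)·((L_μΨ)(u) + iA_μ(u)Ψ(u)) with
coefficient fields γ and A on the frame bundle ℝ⁴ × Matrix (Fin 4) (Fin 4) ℝ. -/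
noncomputable def diracOp
    (γ : (Fin 4 → ℝ) × Matrix (Fin 4) (Fin 4) ℝ → Fin 4 → Matrix (Fin 4) (Fin 4) ℂ)
    (A : (Fin 4 → ℝ) × Matrix (Fin 4) (Fin 4) ℝ → Fin 4 → ℝ)
    (Ψ : (Fin 4 → ℝ) × Matrix (Fin 4) (Fin 4) ℝ → (Fin 4 → ℂ))
    (u : (Fin 4 → ℝ) × Matrix (Fin 4) (Fin 4) ℝ) : Fin 4 → ℂ :=
  ∑ μ : Fin 4, (γ u μ).mulVec (Lfund μ Ψ u + (Complex.I * ((A u μ : ℝ) : ℂ)) • Ψ u)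

/-- The horizontal vector fields commute with pull-back along the bundle map of an affine map. -/
theorem Lfund_comp_affine (Lam : Matrix (Fin 4) (Fin 4) ℝ) (b : Fin 4 → ℝ) (μ : Fin 4)
    (Ψ : (Fin 4 → ℝ) × Matrix (Fin 4) (Fin 4) ℝ → (Fin 4 → ℂ))
    (u : (Fin 4 → ℝ) × Matrix (Fin 4) (Fin 4) ℝ) :
    Lfund μ (fun v => Ψ (Lam.mulVec v.1 + b, Lam * v.2)) u
      = Lfund μ Ψ (Lam.mulVec u.1 + b, Lam * u.2) := by
  have hcol : (fun k => (Lam * u.2) k μ) = Lam.mulVec (fun k => u.2 k μ) := rfl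
  simp only [Lfund, hcol, Matrix.mulVec_add, Matrix.mulVec_smul, add_right_comm]

/-- Poincaré invariance of the Dirac operator over Minkowski space: for a proper
Lorentz matrix Λ and translation b, with F_♭(x,E) = (Λx + b, ΛE),
(D_{[γ,A]}Ψ) ∘ F_♭ = D_{[γ∘F_♭, A∘F_♭]}(Ψ ∘ F_♭). -/
theorem dirac_poincare_invariance
    (Lam : Matrix (Fin 4) (Fin 4) ℝ)
    (hLam1 : Lamᵀ * etaR * Lam = etaR) (hLam2 : Lam.det = 1) (hLam3 : 1 ≤ Lam 0 0)
    (b : Fin 4 → ℝ)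
    (γ : (Fin 4 → ℝ) × Matrix (Fin 4) (Fin 4) ℝ → Fin 4 → Matrix (Fin 4) (Fin 4) ℂ)
    (A : (Fin 4 → ℝ) × Matrix (Fin 4) (Fin 4) ℝ → Fin 4 → ℝ)
    (Ψ : (Fin 4 → ℝ) × Matrix (Fin 4) (Fin 4) ℝ → (Fin 4 → ℂ))
    (hΨ : ∀ E : Matrix (Fin 4) (Fin 4) ℝ, Differentiable ℝ (fun x => Ψ (x, E))) :
    (fun u => diracOp γ A Ψ (Lam.mulVec u.1 + b, Lam * u.2))
      = diracOp (fun u => γ (Lam.mulVec u.1 + b, Lam * u.2))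
          (fun u => A (Lam.mulVec u.1 + b, Lam * u.2))
          (fun u => Ψ (Lam.mulVec u.1 + b, Lam * u.2)) := by
  funext u
  simp only [diracOp, Lfund_comp_affine]
end

section
/- (Transformation of the Dirac operator under a vertical Lorentz gauge change, Minkowski case.) Let η = diag(1,−1,−1,−1). On ℝ⁴ × Matrix (Fin 4) (Fin 4) ℝ define (L_μ Ψ)(x,E) := (d/dt)|_{t=0} Ψ(x + t·(E e_μ), E) for Ψ differentiable in its first variable (E e_μ the μ-th column of E), and for coefficient fields γ : ℝ⁴ × Matrix (Fin 4) (Fin 4) ℝ → (Fin 4 → Matrix (Fin 4) (Fin 4) ℂ) and A : ℝ⁴ × Matrix (Fin 4) (Fin 4) ℝ → (Fin 4 → ℝ) define (D_{[γ,A]} Ψ)(u) := Σ_μ γ^μ(u)·((L_μΨ)(u) + i A_μ(u)Ψ(u)). Let Λ : Matrix (Fin 4) (Fin 4) ℝ → GL(4,ℝ) assign to each frame E an invertible matrix Λ(E) depending only on E (a vertical section), and define the fibre transformation m_Λ(x,E) := (x, E·Λ(E)). Then for every ℂ⁴-valued field Ψ differentiable in the first variable, (D_{[γ,A]} Ψ)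 ∘ m_Λ = D_{[γ̂, Â]}(Ψ ∘ m_Λ), where γ̂^μ(x,E) := Σ_ν Λ(E)^μ_ν · γ^ν(m_Λ(x,E)) and Â_μ(x,E) := Σ_σ (Λ(E)⁻¹)^σ_μ · A_σ(m_Λ(x,E)). -/
open Matrix

theorem sum_sum_smul_mulVec {ι κ m n R : Type*} [Fintype ι] [Fintype κ] [Fintype n]
    [CommSemiring R] (c : ι → κ → R) (G : κ → Matrix m n R) (v : ι → n → R) :
    ∑ i, (∑ k, c i k • G k) *ᵥ v i = ∑ k, G k *ᵥ ∑ i, c i k • v i := by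
  simp only [Matrix.sum_mulVec, Matrix.mulVec_sum, Matrix.smul_mulVec, Matrix.mulVec_smul]
  exact Finset.sum_comm

theorem deriv_comp_add_smul {V F : Type*} [NormedAddCommGroup V] [NormedSpace ℝ V]
    [NormedAddCommGroup F] [NormedSpace ℝ F] {f : V → F} {x : V}
    (hf : DifferentiableAt ℝ f x) (v : V) :
    deriv (fun t : ℝ => f (x + t • v)) 0 = fderiv ℝ f x v :=
  hf.lineDeriv_eq_fderiv

theorem Lfund_mul
    {Ψ : (Fin 4 → ℝ) × Matrix (Fin 4) (Fin 4) ℝ → (Fin 4 → ℂ)}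
    (hΨ : ∀ E : Matrix (Fin 4) (Fin 4) ℝ, Differentiable ℝ (fun x => Ψ (x, E)))
    (Lam : Matrix (Fin 4) (Fin 4) ℝ → Matrix (Fin 4) (Fin 4) ℝ)
    (u : (Fin 4 → ℝ) × Matrix (Fin 4) (Fin 4) ℝ) (ν : Fin 4) :
    Lfund ν Ψ (u.1, u.2 * Lam u.2)
      = ∑ μ, (Lam u.2 μ ν : ℂ) • Lfund μ (fun w => Ψ (w.1, w.2 * Lam w.2)) u := by
  have hd := hΨ (u.2 * Lam u.2) u.1
  have hcol : (fun k => (u.2 * Lam u.2) k ν) = ∑ μ, Lam u.2 μ ν • fun k => u.2 k μ := by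
    ext k
    simp [Matrix.mul_apply, mul_comm]
  have hL : ∀ μ, Lfund μ (fun w => Ψ (w.1, w.2 * Lam w.2)) u
      = fderiv ℝ (fun x => Ψ (x, u.2 * Lam u.2)) u.1 (fun k => u.2 k μ) :=
    fun μ => deriv_comp_add_smul hd _
  calc Lfund ν Ψ (u.1, u.2 * Lam u.2)
      = fderiv ℝ (fun x => Ψ (x, u.2 * Lam u.2)) u.1 (fun k => (u.2 * Lam u.2) k ν) :=
        deriv_comp_add_smul hd _
    _ = _ := by simp only [hcol, map_sum, map_smul, hL, Complex.coe_smul]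

theorem sum_mul_sum_nonsing_inv_mul {n R : Type*} [Fintype n] [DecidableEq n] [CommRing R]
    {M : Matrix n n R} (hM : IsUnit M.det) (a : n → R) (ν : n) :
    ∑ μ, M μ ν * ∑ σ, M⁻¹ σ μ * a σ = a ν := by
  have h : (a ᵥ* M⁻¹) ᵥ* M = a := by
    rw [Matrix.vecMul_vecMul, Matrix.nonsing_inv_mul M hM, Matrix.vecMul_one]
  simpa only [Matrix.vecMul, dotProduct, mul_comm] using congrFun h ν

/-- Transformation of the Dirac operator under a vertical Lorentz gauge change: for a
vertical section E ↦ Λ(E) of invertible matrices, with fibre transformation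
m_Λ(x,E) = (x, E·Λ(E)), one has (D_{[γ,A]}Ψ) ∘ m_Λ = D_{[γ̂,Â]}(Ψ ∘ m_Λ), where
γ̂^μ(x,E) = Σ_ν Λ(E)^μ_ν γ^ν(m_Λ(x,E)) and Â_μ(x,E) = Σ_σ (Λ(E)⁻¹)^σ_μ A_σ(m_Λ(x,E)). -/
theorem dirac_vertical_gauge_transform
    (Lam : Matrix (Fin 4) (Fin 4) ℝ → Matrix (Fin 4) (Fin 4) ℝ)
    (hLam : ∀ E : Matrix (Fin 4) (Fin 4) ℝ, IsUnit (Lam E).det)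
    (γ : (Fin 4 → ℝ) × Matrix (Fin 4) (Fin 4) ℝ → Fin 4 → Matrix (Fin 4) (Fin 4) ℂ)
    (A : (Fin 4 → ℝ) × Matrix (Fin 4) (Fin 4) ℝ → Fin 4 → ℝ)
    (Ψ : (Fin 4 → ℝ) × Matrix (Fin 4) (Fin 4) ℝ → (Fin 4 → ℂ))
    (hΨ : ∀ E : Matrix (Fin 4) (Fin 4) ℝ, Differentiable ℝ (fun x => Ψ (x, E))) :
    (fun u : (Fin 4 → ℝ) × Matrix (Fin 4) (Fin 4) ℝ =>
        diracOp γ A Ψ (u.1, u.2 * Lam u.2))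
      = diracOp
          (fun u μ => ∑ ν : Fin 4, ((Lam u.2 μ ν : ℝ) : ℂ) • γ (u.1, u.2 * Lam u.2) ν)
          (fun u μ => ∑ σ : Fin 4, (Lam u.2)⁻¹ σ μ * A (u.1, u.2 * Lam u.2) σ)
          (fun u => Ψ (u.1, u.2 * Lam u.2)) := by
  funext u
  simp only [diracOp]
  rw [sum_sum_smul_mulVec]
  refine Finset.sum_congr rfl fun ν _ => ?_
  congr 1
  simp only [smul_add, Finset.sum_add_distrib, smul_smul, ← Finset.sum_smul]
  rw [Lfund_mul hΨ]
  congr 2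
  rw [← sum_mul_sum_nonsing_inv_mul (hLam u.2) (A (u.1, u.2 * Lam u.2)) ν,
    Complex.ofReal_sum, Finset.mul_sum]
  refine Finset.sum_congr rfl fun μ _ => ?_
  rw [Complex.ofReal_mul, mul_left_comm]
end
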